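/- arXiv:2309.04009 — 2 statements merged into one kernel-verified Lean document; each statement's English description precedes it below -/
import Mathlib

section
/- Let v₁, …, v_n ∈ ℝ^m, let s > 0 be a real number, and let x ∈ ℝ^n with x_ℓ ≥ 0 for all ℓ and ∑_{ℓ=1}^n x_ℓ = s, such that X := ∑_{ℓ=1}^n x_ℓ v_ℓ v_ℓᵀ is positive definite. Let Θ be an m×m real symmetric positive definite matrix and τ ∈ ℝ be such that v_ℓᵀ Θ v_ℓ ≤ τ for all ℓ = 1, …, n. Then log det X ≤ −log det Θ + τ s − m. -/
open scoped Matrix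

open scoped MatrixOrder in
/-- A positive definite matrix factors as `Bᴴ * B` with `B` invertible. -/
theorem Matrix.PosDef.exists_isUnit_conjTranspose_mul_self {ι : Type*} [Fintype ι] [DecidableEq ι]
    {A : Matrix ι ι ℝ} (hA : A.PosDef) : ∃ B : Matrix ι ι ℝ, IsUnit B ∧ A = Bᴴ * B :=
  CStarAlgebra.isStrictlyPositive_iff_eq_star_mul_self.mp hA.isStrictlyPositive

theorem Matrix.PosDef.log_det_add_card_le_trace {ι : Type*} [Fintype ι] [DecidableEq ι]
    {A : Matrix ι ι ℝ} (hA : A.PosDef) : Real.log A.det + Fintype.card ι ≤ A.trace := by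
  have hpos := hA.eigenvalues_pos
  rw [hA.isHermitian.det_eq_prod_eigenvalues, hA.isHermitian.trace_eq_sum_eigenvalues]
  simp only [RCLike.ofReal_real_eq_id, id_eq]
  rw [Real.log_prod fun i _ ↦ (hpos i).ne']
  have h := Finset.sum_le_sum fun i (_ : i ∈ Finset.univ) ↦ Real.log_le_sub_one_of_pos (hpos i)
  simp only [Finset.sum_sub_distrib, Finset.sum_const, Finset.card_univ, nsmul_eq_mul,
    mul_one] at h
  linarith

theorem Matrix.PosDef.log_det_add_log_det_add_card_le_trace_mul {ι : Type*} [Fintype ι]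
    [DecidableEq ι] {A B : Matrix ι ι ℝ} (hA : A.PosDef) (hB : B.PosDef) :
    Real.log A.det + Real.log B.det + Fintype.card ι ≤ (A * B).trace := by
  obtain ⟨C, hC, rfl⟩ := hA.exists_isUnit_conjTranspose_mul_self
  have hM : (C * B * Cᴴ).PosDef :=
    hB.mul_mul_conjTranspose_same (Matrix.vecMul_injective_of_isUnit hC)
  have h := hM.log_det_add_card_le_trace
  have hdet : (C * B * Cᴴ).det = (Cᴴ * C).det * B.det := by
    simp only [Matrix.det_mul]
    ring
  rw [hdet, Real.log_mul hA.det_pos.ne' hB.det_pos.ne', Matrix.trace_mul_comm,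
    ← Matrix.mul_assoc] at h
  exact h

/-- Weak duality for the natural continuous relaxation of D-optimality: if `x ≥ 0`,
`∑ x_ℓ = s`, `X := ∑ x_ℓ v_ℓ v_ℓᵀ` is positive definite, `Θ` is symmetric positive
definite, and `v_ℓᵀ Θ v_ℓ ≤ τ` for all `ℓ`, then
`log det X ≤ −log det Θ + τ s − m`. -/
theorem weak_duality {m n : ℕ} (v : Fin n → (Fin m → ℝ)) (s : ℝ) (hs : 0 < s)
    (x : Fin n → ℝ) (hx : ∀ ℓ, 0 ≤ x ℓ) (hsum : (∑ ℓ, x ℓ) = s)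
    (X : Matrix (Fin m) (Fin m) ℝ)
    (hX : X = ∑ ℓ : Fin n, x ℓ • Matrix.vecMulVec (v ℓ) (v ℓ))
    (hXpd : X.PosDef)
    (Θ : Matrix (Fin m) (Fin m) ℝ) (hΘ : Θ.PosDef) (τ : ℝ)
    (hfeas : ∀ ℓ, v ℓ ⬝ᵥ Θ *ᵥ v ℓ ≤ τ) :
    Real.log X.det ≤ -Real.log Θ.det + τ * s - m := by
  have h := hΘ.log_det_add_log_det_add_card_le_trace_mul hXpd
  have htr : (Θ * X).trace ≤ τ * s := by
    rw [hX, Matrix.mul_sum, Matrix.trace_sum, ← hsum, Finset.mul_sum]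
    refine Finset.sum_le_sum fun ℓ _ ↦ ?_
    rw [Matrix.mul_smul, Matrix.trace_smul, Matrix.mul_vecMulVec, Matrix.trace_vecMulVec,
      dotProduct_comm, smul_eq_mul, mul_comm τ]
    exact mul_le_mul_of_nonneg_left (hfeas ℓ) (hx ℓ)
  rw [Fintype.card_fin] at h
  linarith
end

section
/- Let v₁, …, v_n ∈ ℝ^m, let R ⊆ {1,…,n}, and let x̃ ∈ ℝ^n with x̃_ℓ ≥ 0 for all ℓ and x̃_ℓ = 0 for ℓ ∉ R, such that B := ∑_{ℓ ∈ R} x̃_ℓ v_ℓ v_ℓᵀ is positive definite. Set τ̃ := max_{ℓ ∈ R} v_ℓᵀ B⁻¹ v_ℓ. Then for every real s > 0 and every x ∈ ℝ^n with x_ℓ ≥ 0 for all ℓ, x_ℓ = 0 for ℓ ∉ R, ∑_{ℓ ∈ R} x_ℓ = s, and ∑_{ℓ ∈ R} x_ℓ v_ℓ v_ℓᵀ positive definite, one has log det ( ∑_{ℓ ∈ R} x_ℓ v_ℓ v_ℓᵀ ) ≤ log det B + τ̃ s − m. -/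
open scoped Matrix

lemma Matrix.PosDef.log_det_le_trace_sub_card {ι : Type*} [Fintype ι] [DecidableEq ι]
    {A : Matrix ι ι ℝ} (hA : A.PosDef) :
    Real.log A.det ≤ A.trace - Fintype.card ι := by
  have hdet : A.det = ∏ i, hA.isHermitian.eigenvalues i := by
    simpa using hA.isHermitian.det_eq_prod_eigenvalues
  have htrace : A.trace = ∑ i, hA.isHermitian.eigenvalues i := by
    simpa using hA.isHermitian.trace_eq_sum_eigenvalues
  rw [hdet, htrace, Real.log_prod fun i _ => (hA.eigenvalues_pos i).ne']
  calc ∑ i, Real.log (hA.isHermitian.eigenvalues i)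
      ≤ ∑ i, (hA.isHermitian.eigenvalues i - 1) :=
        Finset.sum_le_sum fun i _ => Real.log_le_sub_one_of_pos (hA.eigenvalues_pos i)
    _ = ∑ i, hA.isHermitian.eigenvalues i - Fintype.card ι := by simp

open scoped MatrixOrder in
/-- The tangent-plane inequality for the concave function `log det` at `B`. -/
lemma Matrix.PosDef.log_det_le_log_det_add_trace {ι : Type*} [Fintype ι] [DecidableEq ι]
    {A B : Matrix ι ι ℝ} (hA : A.PosDef) (hB : B.PosDef) :
    Real.log A.det ≤ Real.log B.det + (B⁻¹ * A).trace - Fintype.card ι := by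
  obtain ⟨Y, hY⟩ := CStarAlgebra.nonneg_iff_eq_star_mul_self.mp hB.inv.posSemidef.nonneg
  rw [Matrix.star_eq_conjTranspose] at hY
  have hdetY : Yᴴ.det * Y.det = B.det⁻¹ := by
    rw [← Matrix.det_mul, ← hY, Matrix.det_nonsing_inv, Ring.inverse_eq_inv']
  have hYunit : IsUnit Y := by
    rw [Matrix.isUnit_iff_isUnit_det, isUnit_iff_ne_zero]
    exact right_ne_zero_of_mul (hdetY ▸ inv_ne_zero hB.det_pos.ne')
  have hC : (Y * A * Yᴴ).PosDef := (Matrix.IsUnit.posDef_star_right_conjugate_iff hYunit).mpr hA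
  have hdet : (Y * A * Yᴴ).det = A.det * B.det⁻¹ := by
    rw [Matrix.det_mul, Matrix.det_mul, ← hdetY]
    ring
  have htrace : (Y * A * Yᴴ).trace = (B⁻¹ * A).trace := by
    rw [Matrix.trace_mul_comm, ← Matrix.mul_assoc, ← hY]
  have h := hC.log_det_le_trace_sub_card
  rw [hdet, htrace, Real.log_mul hA.det_pos.ne' (inv_ne_zero hB.det_pos.ne'), Real.log_inv] at h
  linarith

/-- Closed-form dual bound from a restricted feasible point: with
`B := ∑_{ℓ∈R} x̃_ℓ v_ℓ v_ℓᵀ` positive definite and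
`τ̃ := max_{ℓ∈R} v_ℓᵀ B⁻¹ v_ℓ`, every feasible `x` supported on `R` with
`∑_{ℓ∈R} x_ℓ = s` and positive definite information matrix satisfies
`log det (∑_{ℓ∈R} x_ℓ v_ℓ v_ℓᵀ) ≤ log det B + τ̃ s − m`. -/
theorem restricted_dual_bound {m n : ℕ} (v : Fin n → (Fin m → ℝ))
    (R : Finset (Fin n)) (hR : R.Nonempty)
    (xt : Fin n → ℝ) (hxt : ∀ ℓ, 0 ≤ xt ℓ) (hxtsupp : ∀ ℓ ∉ R, xt ℓ = 0)
    (B : Matrix (Fin m) (Fin m) ℝ)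
    (hB : B = ∑ ℓ ∈ R, xt ℓ • Matrix.vecMulVec (v ℓ) (v ℓ))
    (hBpd : B.PosDef)
    (τt : ℝ) (hτt : τt = R.sup' hR (fun ℓ => v ℓ ⬝ᵥ B⁻¹ *ᵥ v ℓ)) :
    ∀ (s : ℝ), 0 < s →
      ∀ x : Fin n → ℝ, (∀ ℓ, 0 ≤ x ℓ) → (∀ ℓ ∉ R, x ℓ = 0) →
        (∑ ℓ ∈ R, x ℓ) = s →
        (∑ ℓ ∈ R, x ℓ • Matrix.vecMulVec (v ℓ) (v ℓ)).PosDef →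
        Real.log (∑ ℓ ∈ R, x ℓ • Matrix.vecMulVec (v ℓ) (v ℓ)).det
          ≤ Real.log B.det + τt * s - m := by
  intro s _ x hx _ hsum hA
  have htrace : (B⁻¹ * ∑ ℓ ∈ R, x ℓ • Matrix.vecMulVec (v ℓ) (v ℓ)).trace
      = ∑ ℓ ∈ R, x ℓ * (v ℓ ⬝ᵥ B⁻¹ *ᵥ v ℓ) := by
    simp only [Finset.mul_sum, Matrix.trace_sum, Matrix.mul_smul, Matrix.trace_smul,
      Matrix.mul_vecMulVec, Matrix.trace_vecMulVec, smul_eq_mul, dotProduct_comm]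
  have hbound : ∑ ℓ ∈ R, x ℓ * (v ℓ ⬝ᵥ B⁻¹ *ᵥ v ℓ) ≤ τt * s := by
    rw [← hsum, Finset.mul_sum]
    refine Finset.sum_le_sum fun ℓ hℓ => ?_
    rw [mul_comm τt]
    refine mul_le_mul_of_nonneg_left ?_ (hx ℓ)
    rw [hτt]
    exact Finset.le_sup' (fun ℓ => v ℓ ⬝ᵥ B⁻¹ *ᵥ v ℓ) hℓ
  have h := hA.log_det_le_log_det_add_trace hBpd
  rw [htrace, Fintype.card_fin] at h
  linarith
end
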